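/- Let d = 1 and let μ be a finite Borel measure on T = [-π,π], symmetric about the origin, with dμ = b dλ + dμ_s (μ_s ⊥ λ, b ≥ 0 in L¹(T,λ)). Assume there exist p > 0 and C < ∞ such that λ{t ∈ T : b(t) ≤ δ} ≤ C δ^p for every δ ∈ [0,π]. Then there is a finite constant γ, depending only on C, p and μ̂(0), such that H_X(N) ≥ e^{-γ N log N} for all N ≥ 2. -/

import Mathlib

open MeasureTheory ProbabilityTheory Matrix

noncomputable section

/-- Normalized Lebesgue measure `λ` on `T = [-π,π]`, with `λ(T) = 1`. -/
def normLeb1 : Measure ℝ :=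
  (ENNReal.ofReal (2 * Real.pi))⁻¹ • (volume.restrict (Set.Icc (-Real.pi) Real.pi))

/-- Fourier coefficient `μ̂(m) = ∫_T e^{imt} dμ(t)` for `m ∈ ℤ`. -/
def muHat1 (μ : Measure ℝ) (m : ℤ) : ℂ :=
  ∫ t, Complex.exp (Complex.I * (m : ℂ) * (t : ℂ)) ∂μ

/-- The matrix `Σ_N = (μ̂(j-k))_{1 ≤ j,k ≤ N}` (real, since `μ` is symmetric). -/
def SigmaN (μ : Measure ℝ) (N : ℕ) : Matrix (Fin N) (Fin N) ℝ :=
  fun j k => (muHat1 μ ((j.1 : ℤ) - (k.1 : ℤ))).re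

/-- `X` is a centered Gaussian vector with covariance matrix `S` (under `P`):
every linear combination of the coordinates is a centered one-dimensional
Gaussian with the corresponding variance. -/
def IsCenteredGaussianVec {ι : Type*} [Fintype ι] {Ω : Type*} [MeasurableSpace Ω]
    (P : Measure Ω) (X : ι → Ω → ℝ) (S : Matrix ι ι ℝ) : Prop :=
  ∀ u : ι → ℝ,
    P.map (fun ω => ∑ i, u i * X i ω) =
      gaussianReal 0 (Real.toNNReal (u ⬝ᵥ S.mulVec u))


lemma pi_gauss_eq (N : ℕ) :
    Measure.pi (fun _ : Fin N => gaussianReal 0 1) =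
      (volume : Measure (Fin N → ℝ)).withDensity
        (fun x => ENNReal.ofReal (∏ i, gaussianPDFReal 0 1 (x i))) := by
  refine Measure.pi_eq fun s hs => ?_
  rw [withDensity_apply _ (MeasurableSet.univ_pi hs), volume_pi, Measure.restrict_pi_pi,
    ← ofReal_integral_eq_lintegral_ofReal, integral_fintype_prod_eq_prod,
    ENNReal.ofReal_prod_of_nonneg]
  · refine Finset.prod_congr rfl fun i _ => ?_
    rw [gaussianReal_apply_eq_integral _ one_ne_zero]
  · intro i _
    exact integral_nonneg (gaussianPDFReal_nonneg _ _)
  · exact Integrable.fintype_prod (fun i => (integrable_gaussianPDFReal _ _).restrict)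
  · exact ae_of_all _ fun x => Finset.prod_nonneg fun i _ => gaussianPDFReal_nonneg _ _ _

lemma pi_gauss_lower (N : ℕ) (S : Set (Fin N → ℝ)) (hS : MeasurableSet S)
    (h : ∀ z ∈ S, ∑ i, z i ^ 2 ≤ N) :
    ENNReal.ofReal ((√(2 * Real.pi))⁻¹ ^ N * Real.exp (-(N / 2 : ℝ))) * volume S ≤
      Measure.pi (fun _ : Fin N => gaussianReal 0 1) S := by
  rw [pi_gauss_eq, withDensity_apply _ hS, ← setLIntegral_const]
  refine setLIntegral_mono' hS fun x hx => ENNReal.ofReal_le_ofReal ?_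
  simp only [gaussianPDFReal, Finset.prod_mul_distrib, ← Real.exp_sum]
  simp only [NNReal.coe_one, mul_one, Finset.prod_const, Finset.card_univ, Fintype.card_fin,
    sub_zero]
  gcongr
  rw [← Finset.sum_div, Finset.sum_neg_distrib]
  have := h x hx
  linarith

lemma gauss_law (N : ℕ) {Ω : Type} [MeasurableSpace Ω] (P : Measure Ω) [IsProbabilityMeasure P]
    (X : Fin N → Ω → ℝ) (B : Matrix (Fin N) (Fin N) ℝ)
    (hX : IsCenteredGaussianVec P X (Bᵀ * B)) :
    P.map (fun ω i => X i ω) =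
      (Measure.pi (fun _ : Fin N => gaussianReal 0 1)).map (fun z => Bᵀ *ᵥ z) := by
  have hm : ∀ i, AEMeasurable (X i) P := by
    intro i
    have := hX (Pi.single i 1)
    simp only [Pi.single_apply, ite_mul, one_mul, zero_mul, Finset.sum_ite_eq',
      Finset.mem_univ, if_true] at this
    exact aemeasurable_of_map_neZero (by rw [this]; infer_instance)
  have hm' : AEMeasurable (fun ω i => X i ω) P := aemeasurable_pi_lambda _ hm
  have := Measure.isProbabilityMeasure_map hm'
  let T : (Fin N → ℝ) →L[ℝ] (Fin N → ℝ) := LinearMap.toContinuousLinearMap (Matrix.mulVecLin Bᵀ)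
  have hT : (fun z => Bᵀ *ᵥ z) = (T : (Fin N → ℝ) → (Fin N → ℝ)) := rfl
  have : IsProbabilityMeasure ((Measure.pi (fun _ : Fin N => gaussianReal 0 1)).map
    (fun z => Bᵀ *ᵥ z)) := Measure.isProbabilityMeasure_map (by rw [hT]; fun_prop)
  refine Measure.ext_of_charFunDual ?_
  ext L
  set u : Fin N → ℝ := fun i => L (Pi.single i 1) with hu
  have hL : ∀ v, L v = ∑ i, u i * v i := by
    intro v
    conv_lhs => rw [pi_eq_sum_univ' v]
    simp only [map_sum, map_smul, smul_eq_mul, hu, mul_comm]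
  have hq : u ⬝ᵥ ((Bᵀ * B) *ᵥ u) = ∑ i, ((B *ᵥ u) i) ^ 2 := by
    rw [← Matrix.mulVec_mulVec, Matrix.dotProduct_mulVec, Matrix.vecMul_transpose]
    simp [dotProduct, sq]
  have h1 : charFunDual (P.map (fun ω i => X i ω)) L =
      Complex.exp (-((∑ i, ((B *ᵥ u) i) ^ 2 : ℝ) : ℂ) / 2) := by
    rw [charFunDual_eq_charFun_map_one, AEMeasurable.map_map_of_aemeasurable (by fun_prop) hm']
    have : (L ∘ fun ω i => X i ω) = fun ω => ∑ i, u i * X i ω := by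
      ext ω; simp [hL]
    rw [this, hX u, charFun_gaussianReal, hq, Real.coe_toNNReal _ (by positivity)]
    congr 1
    simp
    ring
  rw [h1, hT, charFunDual_map, charFunDual_pi, Complex.ofReal_sum, ← Finset.sum_neg_distrib,
    Finset.sum_div, Complex.exp_sum]
  refine Finset.prod_congr rfl fun i _ => ?_
  have h2 : ∀ x : ℝ, ((L.comp T).comp (ContinuousLinearMap.single ℝ (fun _ : Fin N => ℝ) i)) x
      = (B *ᵥ u) i * x := by
    intro x
    simp only [ContinuousLinearMap.comp_apply, hL, T, LinearMap.coe_toContinuousLinearMap',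
      Matrix.mulVecLin_apply, ContinuousLinearMap.single_apply, Matrix.mulVec_single,
      Matrix.mulVec, dotProduct, Finset.sum_mul]
    refine Finset.sum_congr rfl fun j _ => ?_
    simp
    ring
  have h3 : charFunDual (gaussianReal 0 1)
      ((L.comp T).comp (ContinuousLinearMap.single ℝ (fun _ : Fin N => ℝ) i)) =
      charFun (gaussianReal 0 1) ((B *ᵥ u) i) := by
    rw [charFunDual_apply, charFun_apply_real]
    simp only [h2, Complex.ofReal_mul]
  rw [h3, charFun_gaussianReal]
  congr 1
  simp
  ring

/-- Orthant bound from a lower bound on the quadratic form and an upper bound on the entries. -/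
lemma orthant_bound (N : ℕ) {Ω : Type} [MeasurableSpace Ω] (P : Measure Ω)
    [IsProbabilityMeasure P]
    (X : Fin N → Ω → ℝ) (S : Matrix (Fin N) (Fin N) ℝ) (hS : S.IsHermitian)
    (l M : ℝ) (hl : 0 < l) (hM : 0 < M)
    (hq : ∀ u : Fin N → ℝ, l * ∑ i, u i ^ 2 ≤ u ⬝ᵥ (S *ᵥ u))
    (hent : ∀ i j, |S i j| ≤ M)
    (hX : IsCenteredGaussianVec P X S) :
    ENNReal.ofReal (((√(2 * Real.pi))⁻¹ ^ N * Real.exp (-(N / 2 : ℝ))) *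
      ((√((N : ℝ) ^ N * M ^ N))⁻¹ * √l ^ N)) ≤
      P {ω | ∀ m : Fin N, 0 < X m ω} := by
  have hps : S.PosSemidef := by
    refine Matrix.posSemidef_iff_dotProduct_mulVec.mpr ⟨hS, fun u => ?_⟩
    simp only [star_trivial]
    exact le_trans (by positivity) (hq u)
  obtain ⟨B, hB⟩ : ∃ B : Matrix (Fin N) (Fin N) ℝ, S = Bᵀ * B := by
    open scoped MatrixOrder in
    obtain ⟨B, hB⟩ := CStarAlgebra.nonneg_iff_eq_star_mul_self.mp hps.nonneg
    exact ⟨B, by rw [hB, Matrix.star_eq_conjTranspose, Matrix.conjTranspose_eq_transpose_of_trivial]⟩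
  subst hB
  have hquad : ∀ u, u ⬝ᵥ ((Bᵀ * B) *ᵥ u) = ∑ i, ((B *ᵥ u) i) ^ 2 := by
    intro u
    rw [← Matrix.mulVec_mulVec, Matrix.dotProduct_mulVec, Matrix.vecMul_transpose]
    simp [dotProduct, sq]
  have hdet : B.det ≠ 0 := by
    intro h0
    obtain ⟨v, hv, hv0⟩ := Matrix.exists_mulVec_eq_zero_iff.mpr h0
    have := hq v
    rw [hquad, hv0] at this
    simp only [Pi.zero_apply, ne_eq, OfNat.ofNat_ne_zero, not_false_eq_true, zero_pow,
      Finset.sum_const_zero] at this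
    have h2 : ∑ i, v i ^ 2 ≤ 0 := by
      by_contra hc
      push Not at hc
      have := mul_pos hl hc
      linarith
    have h3 := (Finset.sum_eq_zero_iff_of_nonneg (fun i _ => sq_nonneg (v i))).mp
      (le_antisymm h2 (by positivity))
    exact hv (funext fun i => by simpa using h3 i (Finset.mem_univ i))
  have hm : ∀ i, AEMeasurable (X i) P := by
    intro i
    have := hX (Pi.single i 1)
    simp only [Pi.single_apply, ite_mul, one_mul, zero_mul, Finset.sum_ite_eq',
      Finset.mem_univ, if_true] at this
    exact aemeasurable_of_map_neZero (by rw [this]; infer_instance)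
  have hm' : AEMeasurable (fun ω i => X i ω) P := aemeasurable_pi_lambda _ hm
  let T : (Fin N → ℝ) →ₗ[ℝ] (Fin N → ℝ) := Matrix.mulVecLin Bᵀ
  have hTm : Measurable (fun z => Bᵀ *ᵥ z) := T.continuous_of_finiteDimensional.measurable
  let O : Set (Fin N → ℝ) := {x | ∀ i, 0 < x i}
  let D : Set (Fin N → ℝ) := Set.univ.pi (fun _ => Set.Ioo 0 (√l))
  have hO : MeasurableSet O := by
    have : O = Set.univ.pi (fun _ => Set.Ioi 0) := by ext; simp [O]
    rw [this]
    exact MeasurableSet.univ_pi fun _ => measurableSet_Ioi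
  have hD : MeasurableSet D := MeasurableSet.univ_pi fun _ => measurableSet_Ioo
  have hDO : D ⊆ O := fun x hx i => (hx i (Set.mem_univ i)).1
  have hP : P {ω | ∀ m : Fin N, 0 < X m ω} =
      Measure.pi (fun _ : Fin N => gaussianReal 0 1) ((fun z => Bᵀ *ᵥ z) ⁻¹' O) := by
    rw [← Measure.map_apply hTm hO, ← gauss_law N P X B hX, Measure.map_apply_of_aemeasurable hm' hO]
    rfl
  have hvolD : volume D = ENNReal.ofReal (√l ^ N) := by
    simp only [D, volume_pi, Measure.pi_pi, Real.volume_Ioo, sub_zero, Finset.prod_const,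
      Finset.card_univ, Fintype.card_fin]
    rw [ENNReal.ofReal_pow (Real.sqrt_nonneg _)]
  have hTdet : LinearMap.det T = B.det := by
    have : T = Matrix.toLin' Bᵀ := rfl
    rw [this, LinearMap.det_toLin', Matrix.det_transpose]
  have hvol : volume ((fun z => Bᵀ *ᵥ z) ⁻¹' D) =
      ENNReal.ofReal (|B.det|⁻¹ * √l ^ N) := by
    have := Measure.addHaar_preimage_linearMap (volume : Measure (Fin N → ℝ)) (f := T)
      (by rw [hTdet]; exact hdet) D
    rw [hTdet, hvolD, abs_inv, ← ENNReal.ofReal_mul (by positivity)] at this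
    exact this
  have hdetle : |B.det| ≤ √((N : ℝ) ^ N * M ^ N) := by
    refine Real.abs_le_sqrt ?_
    have h1 := Matrix.det_le (A := Bᵀ * B) (abv := AbsoluteValue.abs) (x := M) hent
    rw [Matrix.det_mul, Matrix.det_transpose] at h1
    have h2 : B.det * B.det ≤ (N.factorial : ℝ) * M ^ N := by
      have := le_trans (le_abs_self _) h1
      simpa [nsmul_eq_mul] using this
    calc B.det ^ 2 = B.det * B.det := sq _
      _ ≤ (N.factorial : ℝ) * M ^ N := h2
      _ ≤ _ := by
        gcongr
        exact_mod_cast Nat.factorial_le_pow N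
  have hnorm : ∀ z ∈ (fun z => Bᵀ *ᵥ z) ⁻¹' D, ∑ i, z i ^ 2 ≤ N := by
    intro z hz
    have hBu : IsUnit B := (Matrix.isUnit_iff_isUnit_det B).mpr hdet.isUnit
    obtain ⟨w, rfl⟩ := Matrix.mulVec_surjective_iff_isUnit.mpr hBu z
    set x := Bᵀ *ᵥ (B *ᵥ w) with hx
    have hxD : x ∈ D := hz
    have e1 : ∑ i, ((B *ᵥ w) i) ^ 2 = ∑ i, w i * x i := by
      rw [← hquad, ← Matrix.mulVec_mulVec]; rfl
    have e2 := hq w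
    rw [hquad] at e2
    have e3 : ∑ i, w i * x i ≤ ∑ i, (l * w i ^ 2 + 1) / 2 := by
      refine Finset.sum_le_sum fun i _ => ?_
      have hi := hxD i (Set.mem_univ i)
      have hs : √l ^ 2 = l := Real.sq_sqrt hl.le
      have h4 : w i * x i ≤ |w i| * √l := by
        calc w i * x i ≤ |w i| * x i := by gcongr; exact hi.1.le; exact le_abs_self _
          _ ≤ _ := by gcongr; exact hi.2.le
      have h5 := sq_nonneg (|w i| * √l - 1)
      have h6 : (|w i| * √l) ^ 2 = l * w i ^ 2 := by rw [mul_pow, sq_abs, hs, mul_comm]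
      nlinarith
    rw [← Finset.sum_div, Finset.sum_add_distrib, ← Finset.mul_sum] at e3
    simp only [Finset.sum_const, Finset.card_univ, Fintype.card_fin, nsmul_eq_mul, mul_one] at e3
    linarith
  rw [hP]
  calc _ ≤ ENNReal.ofReal ((√(2 * Real.pi))⁻¹ ^ N * Real.exp (-(N / 2 : ℝ))) *
        ENNReal.ofReal (|B.det|⁻¹ * √l ^ N) := by
        rw [ENNReal.ofReal_mul (by positivity)]
        gcongr
    _ ≤ Measure.pi (fun _ : Fin N => gaussianReal 0 1) ((fun z => Bᵀ *ᵥ z) ⁻¹' D) := by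
        rw [← hvol]
        exact pi_gauss_lower N _ (hTm hD) hnorm
    _ ≤ _ := measure_mono (Set.preimage_mono hDO)

lemma muHat_re (μ : Measure ℝ) [IsFiniteMeasure μ] (m : ℤ) :
    (muHat1 μ m).re = ∫ t, Real.cos (m * t) ∂μ := by
  have he : ∀ t : ℝ, Complex.exp (Complex.I * (m : ℂ) * (t : ℂ)) =
      Complex.exp (((m * t : ℝ) : ℂ) * Complex.I) := by
    intro t; congr 1; push_cast; ring
  have hint : Integrable (fun t : ℝ => Complex.exp (((m * t : ℝ) : ℂ) * Complex.I)) μ := by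
    refine Integrable.of_bound (C := 1) (by fun_prop) (ae_of_all _ fun t => ?_)
    rw [Complex.norm_exp_ofReal_mul_I]
  unfold muHat1
  simp only [he]
  have h := integral_re hint
  simp only [RCLike.re_to_complex] at h
  rw [← h]
  simp only [Complex.exp_ofReal_mul_I_re]

/-- The squared modulus of a trigonometric polynomial. -/
def trigQ {N : ℕ} (u : Fin N → ℝ) (t : ℝ) : ℝ :=
  (∑ j, u j * Real.cos (j.1 * t)) ^ 2 + (∑ j, u j * Real.sin (j.1 * t)) ^ 2

lemma trigQ_eq {N : ℕ} (u : Fin N → ℝ) (t : ℝ) :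
    trigQ u t = ∑ j, ∑ k, u j * u k * Real.cos ((((j.1 : ℤ) - (k.1 : ℤ) : ℤ) : ℝ) * t) := by
  unfold trigQ
  rw [sq, sq, Finset.sum_mul_sum, Finset.sum_mul_sum, ← Finset.sum_add_distrib]
  refine Finset.sum_congr rfl fun j _ => ?_
  rw [← Finset.sum_add_distrib]
  refine Finset.sum_congr rfl fun k _ => ?_
  push_cast
  rw [sub_mul, Real.cos_sub]
  ring

lemma trigQ_nonneg {N : ℕ} (u : Fin N → ℝ) (t : ℝ) : 0 ≤ trigQ u t := by
  unfold trigQ; positivity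

lemma trigQ_le {N : ℕ} (u : Fin N → ℝ) (t : ℝ) : trigQ u t ≤ N * ∑ j, u j ^ 2 := by
  unfold trigQ
  have h1 := Finset.sum_mul_sq_le_sq_mul_sq Finset.univ u (fun j => Real.cos (j.1 * t))
  have h2 := Finset.sum_mul_sq_le_sq_mul_sq Finset.univ u (fun j => Real.sin (j.1 * t))
  have h3 : (∑ j : Fin N, Real.cos (j.1 * t) ^ 2) + ∑ j : Fin N, Real.sin (j.1 * t) ^ 2 = N := by
    rw [← Finset.sum_add_distrib]
    simp
  calc _ ≤ _ := add_le_add h1 h2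
    _ = _ := by rw [← mul_add, h3, mul_comm]

lemma trigQ_cont {N : ℕ} (u : Fin N → ℝ) : Continuous (trigQ u) := by
  unfold trigQ; fun_prop

lemma cos_integrable (μ : Measure ℝ) [IsFiniteMeasure μ] (a : ℝ) :
    Integrable (fun t => Real.cos (a * t)) μ :=
  Integrable.of_bound (C := 1) (by fun_prop) (ae_of_all _ fun t => by
    simpa using Real.abs_cos_le_one (a * t))

lemma trigQ_integral {N : ℕ} (μ : Measure ℝ) [IsFiniteMeasure μ] (u : Fin N → ℝ) :
    ∫ t, trigQ u t ∂μ = u ⬝ᵥ (SigmaN μ N *ᵥ u) := by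
  simp only [trigQ_eq, dotProduct, Matrix.mulVec, SigmaN, muHat_re]
  rw [integral_finsetSum]
  · refine Finset.sum_congr rfl fun j _ => ?_
    rw [integral_finsetSum, Finset.mul_sum]
    · refine Finset.sum_congr rfl fun k _ => ?_
      rw [integral_const_mul]
      ring
    · intro k _
      exact (cos_integrable μ _).const_mul _
  · intro j _
    refine integrable_finsetSum _ fun k _ => ?_
    exact (cos_integrable μ _).const_mul _

instance : IsProbabilityMeasure normLeb1 := by
  constructor
  unfold normLeb1
  have : (0 : ℝ) < 2 * Real.pi := by positivity
  rw [Measure.smul_apply, Measure.restrict_apply_univ, Real.volume_Icc, smul_eq_mul,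
    show Real.pi - -Real.pi = 2 * Real.pi by ring]
  exact ENNReal.inv_mul_cancel (by simpa using this) ENNReal.ofReal_ne_top

lemma normLeb_cos (m : ℤ) (hm : m ≠ 0) : ∫ t, Real.cos (m * t) ∂normLeb1 = 0 := by
  unfold normLeb1
  rw [integral_smul_measure, integral_Icc_eq_integral_Ioc,
    ← intervalIntegral.integral_of_le (by linarith [Real.pi_pos]),
    intervalIntegral.integral_comp_mul_left (fun x => Real.cos x) (by exact_mod_cast hm),
    integral_cos]
  simp [Real.sin_int_mul_pi]

lemma trigQ_leb {N : ℕ} (u : Fin N → ℝ) : ∫ t, trigQ u t ∂normLeb1 = ∑ j, u j ^ 2 := by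
  rw [trigQ_integral]
  have : SigmaN normLeb1 N = 1 := by
    ext j k
    rw [SigmaN, muHat_re]
    by_cases h : j = k
    · subst h; simp
    · rw [normLeb_cos, Matrix.one_apply_ne h]
      intro h'
      apply h
      ext
      omega
  rw [this, Matrix.one_mulVec]
  simp [dotProduct, sq]

lemma quad_lower {N : ℕ} (μ μs : Measure ℝ) [IsFiniteMeasure μ] (b : ℝ → ℝ)
    (hb : Integrable b normLeb1)
    (hμ : μ = normLeb1.withDensity (fun t => ENNReal.ofReal (b t)) + μs)
    (δ : ℝ) (hδ : 0 < δ)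
    (hsmall : normLeb1 {t : ℝ | b t ≤ δ} ≤ ENNReal.ofReal (1 / (2 * N))) (hN : 0 < N)
    (u : Fin N → ℝ) :
    δ / 2 * ∑ i, u i ^ 2 ≤ u ⬝ᵥ (SigmaN μ N *ᵥ u) := by
  have hNR : (0 : ℝ) < N := by exact_mod_cast hN
  set U := ∑ i, u i ^ 2 with hU
  have hU0 : 0 ≤ U := by positivity
  have hQm : Measurable (fun t => ENNReal.ofReal (trigQ u t)) :=
    (trigQ_cont u).measurable.ennreal_ofReal
  have hQint : ∀ ν : Measure ℝ, IsFiniteMeasure ν → Integrable (trigQ u) ν := fun ν _ =>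
    Integrable.of_bound (C := N * U) (trigQ_cont u).aestronglyMeasurable (ae_of_all _ fun t => by
      rw [Real.norm_of_nonneg (trigQ_nonneg u t)]; exact trigQ_le u t)
  have e1 : ENNReal.ofReal U = ∫⁻ t, ENNReal.ofReal (trigQ u t) ∂normLeb1 := by
    rw [hU, ← trigQ_leb u, ofReal_integral_eq_lintegral_ofReal (hQint _ inferInstance)
      (ae_of_all _ (trigQ_nonneg u))]
  have e2 : ∫⁻ t, ENNReal.ofReal (b t) * ENNReal.ofReal (trigQ u t) ∂normLeb1 ≤
      ENNReal.ofReal (u ⬝ᵥ (SigmaN μ N *ᵥ u)) := by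
    rw [← trigQ_integral, ofReal_integral_eq_lintegral_ofReal (hQint _ inferInstance)
      (ae_of_all _ (trigQ_nonneg u))]
    have h1 := lintegral_withDensity_eq_lintegral_mul₀ (μ := normLeb1)
      (hb.aemeasurable.ennreal_ofReal) hQm.aemeasurable
    simp only [Pi.mul_apply] at h1
    rw [← h1]
    refine lintegral_mono' ?_ le_rfl
    conv_rhs => rw [hμ]
    exact Measure.le_add_right le_rfl
  have e3 : ENNReal.ofReal δ * ENNReal.ofReal U ≤
      ENNReal.ofReal (u ⬝ᵥ (SigmaN μ N *ᵥ u)) + ENNReal.ofReal (δ * U / 2) := by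
    rw [e1, ← lintegral_const_mul _ hQm]
    calc ∫⁻ t, ENNReal.ofReal δ * ENNReal.ofReal (trigQ u t) ∂normLeb1
        ≤ ∫⁻ t, (ENNReal.ofReal (b t) * ENNReal.ofReal (trigQ u t) +
          {t : ℝ | b t ≤ δ}.indicator (fun _ => ENNReal.ofReal (δ * (N * U))) t) ∂normLeb1 := by
          refine lintegral_mono fun t => ?_
          by_cases ht : b t ≤ δ
          · rw [Set.indicator_of_mem (by exact ht), ← ENNReal.ofReal_mul hδ.le]
            refine le_trans (ENNReal.ofReal_le_ofReal ?_) le_add_self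
            exact mul_le_mul_of_nonneg_left (trigQ_le u t) hδ.le
          · refine le_trans ?_ le_self_add
            gcongr
            exact (not_le.mp ht).le
      _ = ∫⁻ t, ENNReal.ofReal (b t) * ENNReal.ofReal (trigQ u t) ∂normLeb1 +
          ∫⁻ t, {t : ℝ | b t ≤ δ}.indicator (fun _ => ENNReal.ofReal (δ * (N * U))) t
            ∂normLeb1 := by
          exact lintegral_add_left' (hb.aemeasurable.ennreal_ofReal.mul hQm.aemeasurable) _
      _ ≤ _ := by
          refine add_le_add e2 ?_
          refine le_trans (lintegral_indicator_const_le _ _) ?_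
          calc _ ≤ ENNReal.ofReal (δ * (N * U)) * ENNReal.ofReal (1 / (2 * N)) := by gcongr
            _ = _ := by
              rw [← ENNReal.ofReal_mul (by positivity)]
              congr 1
              field_simp
  have hq0 : 0 ≤ u ⬝ᵥ (SigmaN μ N *ᵥ u) := by
    rw [← trigQ_integral]; exact integral_nonneg (trigQ_nonneg u)
  rw [← ENNReal.ofReal_mul hδ.le, ← ENNReal.ofReal_add hq0 (by positivity),
    ENNReal.ofReal_le_ofReal_iff (by positivity)] at e3
  linarith

lemma sigma_symm (μ : Measure ℝ) [IsFiniteMeasure μ] (N : ℕ) : (SigmaN μ N).IsHermitian := by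
  ext j k
  simp only [Matrix.conjTranspose_apply, star_trivial, SigmaN, muHat_re]
  congr 1
  ext t
  rw [← Real.cos_neg]
  congr 1
  push_cast
  ring

lemma sigma_entry (μ : Measure ℝ) [IsFiniteMeasure μ] (N : ℕ) (j k : Fin N) :
    |SigmaN μ N j k| ≤ (muHat1 μ 0).re := by
  rw [SigmaN, muHat_re, muHat_re]
  refine le_trans abs_integral_le_integral_abs ?_
  refine integral_mono (cos_integrable μ _).abs (by simp) fun t => ?_
  simpa using Real.abs_cos_le_one _

lemma final_calc (p C' M' : ℝ) (hp : 0 < p) (hC : 1 ≤ C') (hM : 1 ≤ M') (N : ℕ) (hN : 2 ≤ N) :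
    Real.exp (-(((Real.log (2 * Real.pi) + 1 + Real.log M' + Real.log 2 +
      1 / p * Real.log (2 * C')) / Real.log 2 + 1 + 1 / p) / 2) * (N : ℝ) * Real.log (N : ℝ)) ≤
    ((√(2 * Real.pi))⁻¹ ^ N * Real.exp (-(N / 2 : ℝ))) *
      ((√((N : ℝ) ^ N * M' ^ N))⁻¹ * √((2 * C' * N) ^ (-(1 / p)) / 2) ^ N) := by
  have hN2 : (2 : ℝ) ≤ N := by exact_mod_cast hN
  have hN0 : (0 : ℝ) < N := by linarith
  have hC0 : 0 < C' := by linarith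
  have hM0 : 0 < M' := by linarith
  have hpi := Real.pi_pos
  have hl2 : 0 < Real.log 2 := Real.log_pos (by norm_num)
  have hlN : Real.log 2 ≤ Real.log N := Real.log_le_log (by norm_num) hN2
  have hδ : 0 < (2 * C' * N) ^ (-(1 / p)) := by positivity
  set K := Real.log (2 * Real.pi) + 1 + Real.log M' + Real.log 2 +
      1 / p * Real.log (2 * C') with hK
  have hK0 : 0 ≤ K := by
    have h1 : 0 ≤ Real.log (2 * Real.pi) := Real.log_nonneg (by linarith [Real.pi_gt_three])
    have h2 : 0 ≤ Real.log M' := Real.log_nonneg hM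
    have h3 : 0 ≤ Real.log (2 * C') := Real.log_nonneg (by linarith)
    positivity
  have hsq : √((N : ℝ) ^ N * M' ^ N) = √(N * M') ^ N := by
    rw [← mul_pow, Real.sqrt_eq_rpow, Real.sqrt_eq_rpow, ← Real.rpow_natCast, ← Real.rpow_natCast,
      ← Real.rpow_mul (by positivity), ← Real.rpow_mul (by positivity), mul_comm (1 / 2 : ℝ)]
  rw [hsq, ← Real.le_log_iff_exp_le (by positivity), Real.log_mul (by positivity) (by positivity),
    Real.log_mul (by positivity) (by positivity), Real.log_mul (by positivity) (by positivity),
    Real.log_inv, Real.log_exp, Real.log_pow, Real.log_pow, Real.log_pow, Real.log_inv,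
    Real.log_sqrt (by positivity), Real.log_sqrt (by positivity), Real.log_sqrt (by positivity),
    Real.log_div hδ.ne' (by norm_num), Real.log_rpow (by positivity),
    Real.log_mul (x := 2 * C') (by positivity) (by positivity),
    Real.log_mul (x := (N : ℝ)) (by positivity) (by positivity)]
  have hKN : K ≤ K / Real.log 2 * Real.log N := by
    rw [div_mul_eq_mul_div, le_div_iff₀ hl2]
    gcongr
  have := mul_le_mul_of_nonneg_left hKN hN0.le
  rw [hK] at this ⊢
  nlinarith

/-- If `λ{t : b(t) ≤ δ} ≤ C δ^p` for all `δ ∈ [0,π]`, then there is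
a constant `γ` depending only on `C`, `p` and `μ̂(0)` such that
`H_X(N) ≥ e^{-γ N log N}` for all `N ≥ 2`. -/
theorem persistence_NlogN_lower_bound
    (p C M : ℝ) (hp : 0 < p) :
    ∃ γ : ℝ,
      ∀ (μ μs : Measure ℝ) (b : ℝ → ℝ),
        IsFiniteMeasure μ →
        μ {t : ℝ | ¬ |t| ≤ Real.pi} = 0 →
        μ.map (fun t => -t) = μ →
        Integrable b normLeb1 →
        (∀ᵐ t ∂normLeb1, 0 ≤ b t) →
        μs.MutuallySingular normLeb1 →
        μ = normLeb1.withDensity (fun t => ENNReal.ofReal (b t)) + μs →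
        (∀ δ : ℝ, 0 ≤ δ → δ ≤ Real.pi →
          normLeb1 {t : ℝ | b t ≤ δ} ≤ ENNReal.ofReal (C * δ ^ p)) →
        (muHat1 μ 0).re = M →
        ∀ N : ℕ, 2 ≤ N →
          ∀ (Ω : Type) [MeasurableSpace Ω] (P : Measure Ω),
            IsProbabilityMeasure P →
            ∀ X : Fin N → Ω → ℝ,
              IsCenteredGaussianVec P X (SigmaN μ N) →
              ENNReal.ofReal (Real.exp (-γ * (N : ℝ) * Real.log (N : ℝ))) ≤
                P {ω | ∀ m : Fin N, 0 < X m ω} := by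
  set C' := max C 1 with hC'
  set M' := max M 1 with hM'
  refine ⟨((Real.log (2 * Real.pi) + 1 + Real.log M' + Real.log 2 +
      1 / p * Real.log (2 * C')) / Real.log 2 + 1 + 1 / p) / 2, ?_⟩
  intro μ μs b hfin _ _ hb _ _ hμ hsm hM N hN Ω _ P hP X hX
  have hC1 : 1 ≤ C' := le_max_right _ _
  have hM1 : 1 ≤ M' := le_max_right _ _
  have hN2 : (2 : ℝ) ≤ N := by exact_mod_cast hN
  set δ : ℝ := (2 * C' * N) ^ (-(1 / p)) with hδ
  have hbase : 1 ≤ 2 * C' * N := by nlinarith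
  have hδ0 : 0 < δ := by positivity
  have hδ1 : δ ≤ 1 := Real.rpow_le_one_of_one_le_of_nonpos hbase (by
    have : 0 < 1 / p := by positivity
    linarith)
  have hδp : δ ^ p = (2 * C' * N)⁻¹ := by
    rw [hδ, ← Real.rpow_mul (by positivity), show -(1 / p) * p = -1 by field_simp,
      Real.rpow_neg_one]
  have hsmall : normLeb1 {t : ℝ | b t ≤ δ} ≤ ENNReal.ofReal (1 / (2 * N)) := by
    refine le_trans (hsm δ hδ0.le (by linarith [Real.pi_gt_three])) (ENNReal.ofReal_le_ofReal ?_)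
    rw [hδp]
    calc C * (2 * C' * N)⁻¹ ≤ C' * (2 * C' * N)⁻¹ := by
          gcongr; exact le_max_left _ _
      _ = _ := by field_simp
  refine le_trans (ENNReal.ofReal_le_ofReal (final_calc p C' M' hp hC1 hM1 N hN)) ?_
  refine orthant_bound N P X (SigmaN μ N) (sigma_symm μ N) (δ / 2) M' (by positivity)
    (by positivity) (quad_lower μ μs b hb hμ δ hδ0 hsmall (by omega)) ?_ hX
  intro i j
  exact (sigma_entry μ N i j).trans (hM.le.trans (le_max_left _ _))
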